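/- arXiv:2111.15469 — 2 statements merged into one kernel-verified Lean document; each statement's English description precedes it below -/
import Mathlib

section
/- Let {f_n} be a sequence of nonnegative measurable functions on a probability space (Ω, F, P) such that for every k ∈ ℕ the truncations f_n^{(k)} := f_n · 1_{{k−1 ≤ f_n < k}} converge hereditarily in Cesàro mean, P-a.e., to a measurable function f^{(k)} : Ω → [0, ∞), and set f := Σ_{k∈ℕ} f^{(k)}. Let D ⊆ {f < ∞} be a measurable set with E(f · 1_D) < ∞, and let ε ∈ (0,1). Then there exist K ∈ ℕ and a strictly increasing sequence of indices n_1 < n_2 < ⋯ such that for this subsequence and every further subsequence {m_j} of it, and for every integer L > K, the limit lim_{j→∞} E[ f_{m_j} · 1_{{K ≤ f_{m_j} < L} ∩ D} ] exists and is strictly less than ε. -/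
open MeasureTheory Filter Finset
open scoped ENNReal

/-- The truncation `f^(k) = f · 1_{k-1 ≤ f < k}` of a function `f`. -/
noncomputable def trunc {Ω : Type*} (g : Ω → ℝ) (k : ℕ) : Ω → ℝ :=
  ({ω | (k : ℝ) - 1 ≤ g ω ∧ g ω < k}).indicator g

lemma eventually_lt_of_hereditary_cesaro {a : ℕ → ℝ} {l u : ℝ}
    (h : ∀ φ : ℕ → ℕ, StrictMono φ →
      Tendsto (fun J : ℕ => (∑ j ∈ Finset.range J, a (φ j)) / J) atTop (nhds l))
    (hu : l < u) : ∀ᶠ n in atTop, a n < u := by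
  by_contra hcon
  simp only [not_eventually, not_lt] at hcon
  obtain ⟨φ, hφ, hφu⟩ := extraction_of_frequently_atTop hcon
  refine hu.not_ge (ge_of_tendsto (h φ hφ) ?_)
  filter_upwards [eventually_gt_atTop 0] with J hJ
  rw [le_div_iff₀ (by exact_mod_cast hJ)]
  have := Finset.card_nsmul_le_sum (Finset.range J) (fun j => a (φ j)) u fun j _ => hφu j
  simpa [mul_comm] using this

/-- A real sequence all of whose subsequences have the same Cesàro limit converges. -/
lemma tendsto_of_hereditary_cesaro {a : ℕ → ℝ} {l : ℝ}
    (h : ∀ φ : ℕ → ℕ, StrictMono φ →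
      Tendsto (fun J : ℕ => (∑ j ∈ Finset.range J, a (φ j)) / J) atTop (nhds l)) :
    Tendsto a atTop (nhds l) := by
  refine tendsto_order.2 ⟨fun u hu => ?_, fun u hu => eventually_lt_of_hereditary_cesaro h hu⟩
  have hneg : ∀ᶠ n in atTop, -a n < -u := by
    refine eventually_lt_of_hereditary_cesaro (l := -l) (fun φ hφ => ?_) (neg_lt_neg hu)
    simpa [neg_div] using (h φ hφ).neg
  filter_upwards [hneg] with n hn using neg_lt_neg_iff.1 hn

lemma measurable_trunc {Ω : Type*} [MeasurableSpace Ω] {g : Ω → ℝ} (hg : Measurable g) (k : ℕ) :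
    Measurable (trunc g k) :=
  hg.indicator ((measurableSet_le measurable_const hg).inter
    (measurableSet_lt hg measurable_const))

lemma abs_trunc_le {Ω : Type*} {g : Ω → ℝ} (hg : ∀ ω, 0 ≤ g ω) (k : ℕ) (ω : Ω) :
    |trunc g k ω| ≤ k := by
  unfold trunc
  by_cases h : ω ∈ {ω | (k : ℝ) - 1 ≤ g ω ∧ g ω < k}
  · rw [Set.indicator_of_mem h, abs_of_nonneg (hg ω)]
    exact h.2.le
  · rw [Set.indicator_of_notMem h, abs_zero]
    exact k.cast_nonneg

lemma integrable_trunc {Ω : Type*} [MeasurableSpace Ω] {μ : Measure Ω} [IsFiniteMeasure μ]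
    {g : Ω → ℝ} (hg : Measurable g) (hpos : ∀ ω, 0 ≤ g ω) (k : ℕ) :
    Integrable (trunc g k) μ :=
  Integrable.of_bound (measurable_trunc hg k).aestronglyMeasurable (k : ℝ)
    (ae_of_all _ fun ω => abs_trunc_le hpos k ω)

lemma sum_trunc_eq_indicator {Ω : Type*} (g : Ω → ℝ) {K L : ℕ} (hKL : K ≤ L) (ω : Ω) :
    ∑ k ∈ Finset.Ico K L, trunc g (k + 1) ω =
      ({ω | (K : ℝ) ≤ g ω ∧ g ω < L}).indicator g ω := by
  induction L, hKL using Nat.le_induction with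
  | base =>
    rw [Finset.Ico_self, Finset.sum_empty, Set.indicator_of_notMem]
    exact fun h => (h.1.trans_lt h.2).false
  | succ L hKL ih =>
    rw [Finset.sum_Ico_succ_top hKL, ih]
    have hKL' : (K : ℝ) ≤ L := by exact_mod_cast hKL
    simp only [trunc, Set.indicator_apply, Set.mem_ofPred_eq, Nat.cast_add, Nat.cast_one,
      add_sub_cancel_right]
    split_ifs <;> grind

/-- Hereditary Cesàro convergence of the truncations yields convergence of their integrals. -/
lemma tendsto_integral_trunc {Ω : Type*} [MeasurableSpace Ω] {μ : Measure Ω} [IsFiniteMeasure μ]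
    {f : ℕ → Ω → ℝ} (hmeas : ∀ n, Measurable (f n)) (hpos : ∀ n ω, 0 ≤ f n ω)
    {G : Ω → ℝ} {k : ℕ}
    (hG : ∀ φ : ℕ → ℕ, StrictMono φ → ∀ᵐ ω ∂μ,
      Tendsto (fun J : ℕ => (∑ j ∈ Finset.range J, trunc (f (φ j)) k ω) / J)
        atTop (nhds (G ω))) :
    Tendsto (fun n => ∫ ω, trunc (f n) k ω ∂μ) atTop (nhds (∫ ω, G ω ∂μ)) := by
  refine tendsto_of_hereditary_cesaro fun φ hφ => ?_
  have hlim := tendsto_integral_of_dominated_convergence (μ := μ)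
    (F := fun (J : ℕ) ω => (∑ j ∈ Finset.range J, trunc (f (φ j)) k ω) / J)
    (f := G) (fun _ => (k : ℝ))
    (fun J => ((Finset.measurable_fun_sum _ fun j _ =>
      measurable_trunc (hmeas (φ j)) k).div_const _).aestronglyMeasurable)
    (integrable_const _) (fun J => ae_of_all _ fun ω => ?_) (hG φ hφ)
  · refine hlim.congr fun J => ?_
    rw [integral_div, integral_finsetSum _ fun j _ => integrable_trunc (hmeas _) (hpos _) k]
  · rw [Real.norm_eq_abs, abs_div, Nat.abs_cast]
    refine div_le_of_le_mul₀ (Nat.cast_nonneg _) (Nat.cast_nonneg _) ?_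
    refine (Finset.abs_sum_le_sum_abs _ _).trans ?_
    refine (Finset.sum_le_card_nsmul _ _ (k : ℝ) fun j _ => abs_trunc_le (hpos _) k ω).trans ?_
    simp [mul_comm]

/-- Suppose the truncations `f_n^(k)` converge hereditarily in Cesàro mean to `F k`, set
`f = ∑_k F k`, and let `D ⊆ {f < ∞}` satisfy `E(f·1_D) < ∞`. Then for any `ε ∈ (0,1)`
there are `K ∈ ℕ` and a subsequence such that, along it and along every further
subsequence, for every `L > K` the expectations `E[f_n · 1_{{K ≤ f_n < L} ∩ D}]` converge
to a limit `< ε`. -/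
theorem truncated_expectation_small {Ω : Type*} [MeasurableSpace Ω] (P : Measure Ω)
    [IsProbabilityMeasure P] (f : ℕ → Ω → ℝ)
    (hmeas : ∀ n, Measurable (f n)) (hpos : ∀ n ω, 0 ≤ f n ω)
    (F : ℕ → Ω → ℝ) (hFmeas : ∀ k, Measurable (F k)) (hFpos : ∀ k ω, 0 ≤ F k ω)
    (hF : ∀ k : ℕ, 1 ≤ k → ∀ φ : ℕ → ℕ, StrictMono φ →
      ∀ᵐ ω ∂P, Tendsto
        (fun J : ℕ => (∑ j ∈ Finset.range J, trunc (f (φ j)) k ω) / J)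
        atTop (nhds (F k ω)))
    (D : Set Ω) (hD : MeasurableSet D)
    (hDfin : D ⊆ {ω | (∑' k : ℕ, ENNReal.ofReal (F (k + 1) ω)) ≠ ⊤})
    (hint : ∫⁻ ω in D, (∑' k : ℕ, ENNReal.ofReal (F (k + 1) ω)) ∂P < ⊤)
    (ε : ℝ) (hε : ε ∈ Set.Ioo (0 : ℝ) 1) :
    ∃ K : ℕ, ∃ n : ℕ → ℕ, StrictMono n ∧
      ∀ φ : ℕ → ℕ, StrictMono φ → ∀ L : ℕ, K < L →
        ∃ l : ℝ, l < ε ∧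
          Tendsto
            (fun j : ℕ =>
              ∫ ω in ({ω | (K : ℝ) ≤ f (n (φ j)) ω ∧ f (n (φ j)) ω < L} ∩ D),
                f (n (φ j)) ω ∂P)
            atTop (nhds l) := by
  set a : ℕ → ℝ := fun k => ∫ ω in D, F (k + 1) ω ∂P with ha
  have ha_nonneg : ∀ k, 0 ≤ a k := fun k => integral_nonneg fun ω => hFpos _ ω
  have ha_summable : Summable a := by
    rw [lintegral_tsum fun k => (hFmeas (k + 1)).ennreal_ofReal.aemeasurable] at hint
    refine (ENNReal.summable_toReal hint.ne).congr fun k => ?_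
    exact (integral_eq_lintegral_of_nonneg_ae (ae_of_all _ fun ω => hFpos _ ω)
      (hFmeas _).aestronglyMeasurable).symm
  obtain ⟨K, hK⟩ := ((tendsto_order.1 (tendsto_sum_nat_add a)).2 ε hε.1).exists
  refine ⟨K, id, strictMono_id, fun φ hφ L hKL => ⟨∑ k ∈ Finset.Ico K L, a k, ?_, ?_⟩⟩
  · refine lt_of_le_of_lt ?_ hK
    rw [Finset.sum_Ico_eq_sum_range]
    simp only [add_comm K]
    exact ((summable_nat_add_iff K).2 ha_summable).sum_le_tsum _ fun k _ => ha_nonneg _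
  · have hlim : Tendsto (fun n => ∑ k ∈ Finset.Ico K L, ∫ ω in D, trunc (f n) (k + 1) ω ∂P)
        atTop (nhds (∑ k ∈ Finset.Ico K L, a k)) :=
      tendsto_finsetSum _ fun k _ => tendsto_integral_trunc hmeas hpos fun ψ hψ =>
        ae_restrict_of_ae (hF (k + 1) (Nat.le_add_left 1 k) ψ hψ)
    refine (hlim.comp hφ.tendsto_atTop).congr fun j => ?_
    have hset : MeasurableSet {ω | (K : ℝ) ≤ f (φ j) ω ∧ f (φ j) ω < L} :=
      (measurableSet_le measurable_const (hmeas _)).inter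
        (measurableSet_lt (hmeas _) measurable_const)
    simp only [Function.comp_apply, id_eq]
    rw [← integral_finsetSum _ fun k _ => integrable_trunc (hmeas _) (hpos _) (k + 1),
      ← Measure.restrict_restrict hset, ← integral_indicator hset]
    simp only [sum_trunc_eq_indicator _ hKL.le]
end

section
/- Let {f_n} be a sequence of measurable functions on a probability space (Ω, F, P) that is uniformly bounded: there is M < ∞ with |f_n| ≤ M P-a.e. for all n. Then there exist a measurable function f with |f| ≤ M P-a.e. and a strictly increasing sequence of indices n_1 < n_2 < ⋯ such that the subsequence {f_{n_k}} converges hereditarily in Cesàro mean to f, P-a.e.; moreover, for every further subsequence the Cesàro averages also converge to f in L¹(P). -/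
open MeasureTheory Filter Finset

open Topology

/-- A bounded sequence in a separable real Hilbert space has a weakly convergent subsequence. -/
lemma exists_subseq_tendsto_inner_of_separable {H : Type*} [NormedAddCommGroup H]
    [InnerProductSpace ℝ H] [CompleteSpace H] [TopologicalSpace.SeparableSpace H]
    {x : ℕ → H} {B : ℝ} (hB : ∀ n, ‖x n‖ ≤ B) :
    ∃ (y : H) (ψ : ℕ → ℕ), StrictMono ψ ∧
      ∀ v, Tendsto (fun k => inner ℝ (x (ψ k)) v) atTop (𝓝 (inner ℝ y v)) := by
  obtain ⟨ξ, -, ψ, hψ, hlim⟩ := WeakDual.isSeqCompact_closedBall ℝ H 0 B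
    (x := fun n => StrongDual.toWeakDual (InnerProductSpace.toDual ℝ H (x n)))
    (fun n => by simpa using hB n)
  refine ⟨(InnerProductSpace.toDual ℝ H).symm (WeakDual.toStrongDual ξ), ψ, hψ, fun v => ?_⟩
  rw [InnerProductSpace.toDual_symm_apply]
  exact ((WeakDual.eval_continuous v).tendsto ξ).comp hlim

/-- A bounded sequence in a real Hilbert space has a subsequence converging weakly, when tested
against the sequence itself and the limit. -/
lemma exists_subseq_tendsto_inner {H : Type*} [NormedAddCommGroup H]
    [InnerProductSpace ℝ H] [CompleteSpace H] {x : ℕ → H} {B : ℝ} (hB : ∀ n, ‖x n‖ ≤ B) :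
    ∃ (y : H) (ψ : ℕ → ℕ), StrictMono ψ ∧
      (∀ i, Tendsto (fun k => inner ℝ (x (ψ k)) (x i)) atTop (𝓝 (inner ℝ y (x i)))) ∧
      Tendsto (fun k => inner ℝ (x (ψ k)) y) atTop (𝓝 (inner ℝ y y)) := by
  set V : Submodule ℝ H := (Submodule.span ℝ (Set.range x)).topologicalClosure with hV
  have hxV : ∀ n, x n ∈ V := fun n =>
    Submodule.le_topologicalClosure _ (Submodule.subset_span ⟨n, rfl⟩)
  have : CompleteSpace V :=
    (Submodule.isClosed_topologicalClosure _).completeSpace_coe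
  have : TopologicalSpace.SeparableSpace V := by
    have hs : TopologicalSpace.IsSeparable (V : Set H) := by
      rw [hV, Submodule.topologicalClosure_coe]
      exact ((Set.countable_range x).isSeparable.span).closure
    exact hs.separableSpace
  obtain ⟨y, ψ, hψ, h⟩ := exists_subseq_tendsto_inner_of_separable
    (x := fun n => (⟨x n, hxV n⟩ : V)) (B := B) (fun n => hB n)
  exact ⟨y, ψ, hψ, fun i => h ⟨x i, hxV i⟩, h y⟩

/-- Partial sums of a bounded, summably almost orthogonal sequence have norm `O(√K)`. -/
lemma norm_sum_sq_le_of_abs_inner_le {H : Type*} [NormedAddCommGroup H]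
    [InnerProductSpace ℝ H] {g : ℕ → H} {B : ℝ} (hB : ∀ n, ‖g n‖ ≤ B)
    (hg : ∀ j k, j < k → |inner ℝ (g j) (g k)| ≤ (1 / 2 : ℝ) ^ j) (K : ℕ) :
    ‖∑ k ∈ Finset.range K, g k‖ ^ 2 ≤ (B ^ 2 + 4) * K := by
  induction K with
  | zero => simp
  | succ K ih =>
    rw [Finset.sum_range_succ, norm_add_sq_real, sum_inner]
    have h1 : ∑ j ∈ Finset.range K, inner ℝ (g j) (g K) ≤ 2 :=
      (Finset.sum_le_sum fun j hj =>
        (le_abs_self _).trans (hg j K (Finset.mem_range.1 hj))).trans (sum_geometric_two_le K)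
    have h2 : ‖g K‖ ^ 2 ≤ B ^ 2 := pow_le_pow_left₀ (norm_nonneg _) (hB K) 2
    push_cast
    linarith

/-- A bounded sequence in a Hilbert space has a subsequence all of whose further subsequences,
once centred at a common limit, have partial sums of norm `O(√K)`. -/
lemma exists_subseq_hereditary_norm_sum_sq_le {H : Type*} [NormedAddCommGroup H]
    [InnerProductSpace ℝ H] [CompleteSpace H] {x : ℕ → H} {B : ℝ} (hB : ∀ n, ‖x n‖ ≤ B) :
    ∃ (y : H) (n : ℕ → ℕ) (C : ℝ), StrictMono n ∧ ∀ φ : ℕ → ℕ, StrictMono φ → ∀ K : ℕ,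
      ‖∑ k ∈ Finset.range K, (x (n (φ k)) - y)‖ ^ 2 ≤ C * K := by
  obtain ⟨y, ψ, hψ, hx, hy⟩ := exists_subseq_tendsto_inner hB
  have hzero : ∀ j, Tendsto (fun k => inner ℝ (x j - y) (x (ψ k) - y)) atTop (𝓝 0) := by
    intro j
    have := ((hx j).sub_const (inner ℝ y (x j))).sub (hy.sub_const (inner ℝ y y))
    simp only [sub_self] at this
    refine this.congr fun k => ?_
    rw [inner_sub_left, inner_sub_right, inner_sub_right, real_inner_comm (x (ψ k)) (x j),
      real_inner_comm y (x j), real_inner_comm (x (ψ k)) y]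
  obtain ⟨σ, -, hσ⟩ := exists_seq_of_forall_finset_exists (fun _ : ℕ => True)
    (fun i j => i < j ∧ |inner ℝ (x (ψ i) - y) (x (ψ j) - y)| ≤ (1 / 2 : ℝ) ^ i) (by
      intro s _
      have : ∀ᶠ k in atTop, ∀ i ∈ s,
          i < k ∧ |inner ℝ (x (ψ i) - y) (x (ψ k) - y)| ≤ (1 / 2 : ℝ) ^ i := by
        rw [Filter.eventually_all_finset]
        intro i _
        have h0 := (hzero (ψ i)).abs
        rw [abs_zero] at h0
        exact (eventually_gt_atTop i).and (h0.eventually_le_const (by positivity))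
      obtain ⟨k, hk⟩ := this.exists
      exact ⟨k, trivial, hk⟩)
  have hσm : StrictMono σ := fun i j hij => (hσ i j hij).1
  refine ⟨y, ψ ∘ σ, (B + ‖y‖) ^ 2 + 4, hψ.comp hσm, fun φ hφ K => ?_⟩
  refine norm_sum_sq_le_of_abs_inner_le (g := fun k => x ((ψ ∘ σ) (φ k)) - y)
    (fun k => (norm_sub_le _ _).trans (by gcongr; exact hB _)) (fun j k hjk => ?_) K
  exact (hσ _ _ (hφ hjk)).2.trans
    (pow_le_pow_of_le_one (by norm_num) (by norm_num) ((hσm.comp hφ).le_apply))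

/-- If the partial sums of a sequence in `L²` have norm `O(√K)`, then its Cesàro averages
converge to zero almost everywhere along the fourth powers. -/
lemma ae_tendsto_sum_div_pow_four {Ω : Type*} [MeasurableSpace Ω] {P : Measure Ω}
    {G : ℕ → Lp ℝ 2 P} {C : ℝ}
    (hG : ∀ K : ℕ, ‖∑ k ∈ Finset.range K, G k‖ ^ 2 ≤ C * K) :
    ∀ᵐ ω ∂P, Tendsto (fun m : ℕ => (∑ k ∈ Finset.range ((m + 1) ^ 4), G k ω) /
      (((m + 1) ^ 4 : ℕ) : ℝ)) atTop (𝓝 0) := by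
  set u : ℕ → Lp ℝ 2 P := fun m =>
    ((((m + 1) ^ 4 : ℕ) : ℝ)⁻¹) • ∑ k ∈ Finset.range ((m + 1) ^ 4), G k with hu
  have hnorm : ∀ m, ‖u m‖ ≤ √C * (1 / ((m + 1 : ℕ) : ℝ) ^ 2) := by
    intro m
    have h1 : ‖∑ k ∈ Finset.range ((m + 1) ^ 4), G k‖ ≤ √C * ((m + 1 : ℕ) : ℝ) ^ 2 := by
      have := Real.le_sqrt_of_sq_le (hG ((m + 1) ^ 4))
      rwa [Real.sqrt_mul' _ (by positivity), show ((((m + 1) ^ 4 : ℕ)) : ℝ)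
        = (((m + 1 : ℕ) : ℝ) ^ 2) ^ 2 by push_cast; ring, Real.sqrt_sq (by positivity)] at this
    rw [hu, norm_smul, Real.norm_of_nonneg (by positivity)]
    calc _ ≤ ((((m + 1) ^ 4 : ℕ) : ℝ)⁻¹) * (√C * ((m + 1 : ℕ) : ℝ) ^ 2) := by gcongr
      _ = _ := by push_cast; field_simp
  have hsum : Summable fun m => ‖u m‖ := by
    refine Summable.of_nonneg_of_le (fun _ => norm_nonneg _) hnorm (Summable.mul_left _ ?_)
    exact (summable_nat_add_iff (f := fun n : ℕ => 1 / (n : ℝ) ^ 2) 1).2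
      (Real.summable_one_div_nat_pow.2 one_lt_two)
  have hcoe : ∀ᵐ ω ∂P, ∀ m, u m ω =
      (∑ k ∈ Finset.range ((m + 1) ^ 4), G k ω) / (((m + 1) ^ 4 : ℕ) : ℝ) := by
    rw [ae_all_iff]
    intro m
    filter_upwards [Lp.coeFn_smul ((((m + 1) ^ 4 : ℕ) : ℝ)⁻¹)
        (∑ k ∈ Finset.range ((m + 1) ^ 4), G k),
      Lp.coeFn_fun_finsetSum (Finset.range ((m + 1) ^ 4)) G] with ω h1 h2
    rw [hu, h1, Pi.smul_apply, h2, smul_eq_mul, div_eq_inv_mul]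
  filter_upwards [hcoe, Lp.hasSum_coeFn_tsum (tsum_enorm_ne_top_iff_summable_norm.2 hsum)]
    with ω h1 h2
  simpa only [h1] using h2.summable.tendsto_atTop_zero

/-- For a bounded sequence, convergence of the Cesàro averages along the fourth powers implies
their convergence. -/
lemma tendsto_sum_div_of_tendsto_pow_four {a : ℕ → ℝ} {M l : ℝ} (ha : ∀ k, |a k| ≤ M)
    (h : Tendsto (fun m : ℕ => (∑ k ∈ Finset.range ((m + 1) ^ 4), a k) /
      (((m + 1) ^ 4 : ℕ) : ℝ)) atTop (𝓝 l)) :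
    Tendsto (fun K : ℕ => (∑ k ∈ Finset.range K, a k) / (K : ℝ)) atTop (𝓝 l) := by
  have hshift : ∀ K : ℕ, K ≠ 0 → (∑ k ∈ Finset.range K, (a k + M)) / (K : ℝ) =
      (∑ k ∈ Finset.range K, a k) / (K : ℝ) + M := by
    intro K hK
    have : (K : ℝ) ≠ 0 := by exact_mod_cast hK
    rw [Finset.sum_add_distrib, Finset.sum_const, Finset.card_range, nsmul_eq_mul]
    field_simp
  have key := tendsto_div_of_monotone_of_exists_subseq_tendsto_div
    (fun K => ∑ k ∈ Finset.range K, (a k + M)) (l + M) (monotone_nat_of_le_succ fun K => by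
      rw [Finset.sum_range_succ]
      linarith [neg_le_of_abs_le (ha K)]) (fun b hb => ⟨fun m => (m + 1) ^ 4, ?_, ?_, ?_⟩)
  · have := (key.sub_const M).congr' (f₂ := fun K : ℕ => (∑ k ∈ Finset.range K, a k) / (K : ℝ)) (by
      filter_upwards [eventually_ne_atTop 0] with K hK
      rw [hshift K hK, add_sub_cancel_right])
    simpa using this
  · have h1 : Tendsto (fun m : ℕ => (1 + 1 / ((m : ℝ) + 1)) ^ 4) atTop (𝓝 1) := by
      simpa using (tendsto_one_div_add_atTop_nhds_zero_nat (𝕜 := ℝ)).const_add 1 |>.pow 4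
    filter_upwards [h1.eventually_le_const hb] with m hm
    have : (((m + 1 + 1) ^ 4 : ℕ) : ℝ) =
        (1 + 1 / ((m : ℝ) + 1)) ^ 4 * (((m + 1) ^ 4 : ℕ) : ℝ) := by
      push_cast
      field_simp
    rw [this]
    gcongr
  · exact (tendsto_pow_atTop (by norm_num)).comp (tendsto_add_atTop_nat 1)
  · exact (h.add_const M).congr fun m => (hshift _ (by positivity)).symm

/-- A uniformly bounded sequence of measurable functions admits a subsequence converging
hereditarily in Cesàro mean `P`-a.e. to a measurable function `f` bounded by the same
constant; moreover, along every further subsequence the Cesàro averages converge to `f`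
in `L¹(P)` as well. -/
theorem hereditary_cesaro_of_uniformly_bounded {Ω : Type*} [MeasurableSpace Ω]
    (P : Measure Ω) [IsProbabilityMeasure P] (f : ℕ → Ω → ℝ)
    (hmeas : ∀ n, Measurable (f n))
    (M : ℝ) (hM : ∀ n, ∀ᵐ ω ∂P, |f n ω| ≤ M) :
    ∃ fstar : Ω → ℝ, Measurable fstar ∧ (∀ᵐ ω ∂P, |fstar ω| ≤ M) ∧
      ∃ n : ℕ → ℕ, StrictMono n ∧
        (∀ φ : ℕ → ℕ, StrictMono φ →
          ∀ᵐ ω ∂P, Tendsto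
            (fun K : ℕ => (∑ k ∈ Finset.range K, f (n (φ k)) ω) / K)
            atTop (nhds (fstar ω))) ∧
        (∀ φ : ℕ → ℕ, StrictMono φ →
          Tendsto
            (fun K : ℕ =>
              ∫ ω, |(∑ k ∈ Finset.range K, f (n (φ k)) ω) / K - fstar ω| ∂P)
            atTop (nhds 0)) := by
  have hmem : ∀ n, MemLp (f n) 2 P := fun n =>
    MemLp.of_bound (hmeas n).aestronglyMeasurable M (hM n)
  have hnorm : ∀ n, ‖(hmem n).toLp (f n)‖ ≤ |M| := by
    intro n
    have := Lp.norm_le_of_ae_bound (f := (hmem n).toLp (f n)) (abs_nonneg M) (by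
      filter_upwards [(hmem n).coeFn_toLp, hM n] with ω h1 h2
      rw [h1]
      exact h2.trans (le_abs_self M))
    simpa [measureUnivNNReal] using this
  obtain ⟨y, n, C, hn, hC⟩ := exists_subseq_hereditary_norm_sum_sq_le hnorm
  have hbdd : ∀ᵐ ω ∂P, ∀ k, |f k ω| ≤ M := ae_all_iff.2 hM
  have havg : ∀ ω, (∀ k, |f k ω| ≤ M) → ∀ (φ : ℕ → ℕ) (K : ℕ),
      |(∑ k ∈ Finset.range K, f (n (φ k)) ω) / K| ≤ M := by
    intro ω hω φ K
    have hM0 : 0 ≤ M := (abs_nonneg _).trans (hω 0)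
    rw [abs_div, Nat.abs_cast]
    refine div_le_of_le_mul₀ (Nat.cast_nonneg K) hM0 ?_
    calc _ ≤ ∑ k ∈ Finset.range K, |f (n (φ k)) ω| := Finset.abs_sum_le_sum_abs _ _
      _ ≤ ∑ k ∈ Finset.range K, M := Finset.sum_le_sum fun k _ => hω _
      _ = M * K := by simp [mul_comm]
  have hae : ∀ φ : ℕ → ℕ, StrictMono φ → ∀ᵐ ω ∂P, Tendsto
      (fun K : ℕ => (∑ k ∈ Finset.range K, f (n (φ k)) ω) / K) atTop (𝓝 (y ω)) := by
    intro φ hφ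
    have hcoe : ∀ᵐ ω ∂P, ∀ k, ((hmem (n (φ k))).toLp (f (n (φ k))) - y : Lp ℝ 2 P) ω =
        f (n (φ k)) ω - y ω := by
      rw [ae_all_iff]
      intro k
      filter_upwards [Lp.coeFn_sub ((hmem (n (φ k))).toLp (f (n (φ k)))) y,
        (hmem (n (φ k))).coeFn_toLp] with ω h1 h2
      rw [h1, Pi.sub_apply, h2]
    filter_upwards [hbdd, hcoe, ae_tendsto_sum_div_pow_four (hC φ hφ)] with ω hω h1 h2
    refine tendsto_sum_div_of_tendsto_pow_four (fun k => hω _) ?_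
    simp only [h1] at h2
    have h3 := h2.add_const (y ω)
    rw [zero_add] at h3
    refine h3.congr fun m => ?_
    rw [Finset.sum_sub_distrib, Finset.sum_const, Finset.card_range, nsmul_eq_mul]
    field_simp
    ring
  have hy : ∀ᵐ ω ∂P, |y ω| ≤ M := by
    filter_upwards [hbdd, hae id strictMono_id] with ω hω h
    exact le_of_tendsto h.abs (Eventually.of_forall (havg ω hω id))
  have hymeas : Measurable y := (Lp.stronglyMeasurable y).measurable
  refine ⟨y, hymeas, hy, n, hn, hae, fun φ hφ => ?_⟩
  have := tendsto_integral_of_dominated_convergence (μ := P)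
    (F := fun (K : ℕ) ω => |(∑ k ∈ Finset.range K, f (n (φ k)) ω) / K - y ω|)
    (f := fun _ => 0) (fun _ => M + M) (fun K => ?_) (integrable_const _) (fun K => ?_) ?_
  · simpa using this
  · have : Measurable fun ω => ∑ k ∈ Finset.range K, f (n (φ k)) ω :=
      Finset.measurable_fun_sum _ fun k _ => hmeas _
    exact ((this.div_const _).sub hymeas).abs.aestronglyMeasurable
  · filter_upwards [hbdd, hy] with ω hω h
    rw [Real.norm_eq_abs, abs_abs]
    exact (abs_sub _ _).trans (add_le_add (havg ω hω φ K) h)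
  · filter_upwards [hae φ hφ] with ω h
    simpa using (h.sub_const (y ω)).abs
end
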